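/- arXiv:2602.14765 — 6 statements merged into one kernel-verified Lean document; each statement's English description precedes it below -/
import Mathlib

section
/- Let C : ℝ → ℝ^{p×n} be entrywise continuous, let α, T > 0, let N > 0 be a real constant, and define C̄(t) = (1/N) C(t)ᵀ C(t). If C satisfies PE(α,T), i.e. for every t ≥ 0 the matrix ∫_t^{t+T} C(τ)ᵀ C(τ) dτ − α·Iₙ is positive semidefinite, then C̄² satisfies PE(α²/(T N²), T): for every t ≥ 0, the matrix ∫_t^{t+T} C̄(τ)² dτ − (α²/(T N²))·Iₙ is positive semidefinite. -/
open Matrix MeasureTheory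

/-- A matrix-valued function `F` satisfies the persistency-of-excitation condition
`PE(α, T)`: for all `t ≥ 0`, `∫_t^{t+T} F(τ)ᵀ F(τ) dτ − α·Iₙ` is positive semidefinite
(the integral is taken entrywise). -/
def IsPE {p n : ℕ} (F : ℝ → Matrix (Fin p) (Fin n) ℝ) (α T : ℝ) : Prop :=
  ∀ t : ℝ, 0 ≤ t →
    Matrix.PosSemidef
      ((Matrix.of fun i j => ∫ τ in t..(t + T), ((F τ)ᵀ * F τ) i j) -
        α • (1 : Matrix (Fin n) (Fin n) ℝ))

/-- The entrywise integral of a continuous family of positive semidefinite matrices is positive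
semidefinite. -/
theorem posSemidef_intervalIntegral {n : Type*} [Fintype n] {A : ℝ → Matrix n n ℝ} {a b : ℝ}
    (hab : a ≤ b) (hcont : ∀ i j, Continuous fun t => A t i j) (hA : ∀ t, (A t).PosSemidef) :
    (Matrix.of fun i j => ∫ t in a..b, A t i j).PosSemidef := by
  refine .of_dotProduct_mulVec_nonneg ?_ fun x => ?_
  · ext i j
    simp only [conjTranspose_apply, of_apply, star_trivial]
    congr 1 with t
    simpa using (hA t).isHermitian.apply i j
  · have hquad : star x ⬝ᵥ ((Matrix.of fun i j => ∫ t in a..b, A t i j) *ᵥ x) =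
        ∫ t in a..b, star x ⬝ᵥ (A t *ᵥ x) := by
      simp only [dotProduct, mulVec, of_apply]
      rw [intervalIntegral.integral_finsetSum fun i _ =>
        Continuous.intervalIntegrable (by fun_prop) _ _]
      refine Finset.sum_congr rfl fun i _ => ?_
      rw [intervalIntegral.integral_const_mul,
        intervalIntegral.integral_finsetSum fun j _ =>
          Continuous.intervalIntegrable (by fun_prop) _ _]
      simp only [intervalIntegral.integral_mul_const]
    rw [hquad]
    exact intervalIntegral.integral_nonneg hab fun t _ => (hA t).dotProduct_mulVec_nonneg x

/-- If `∫ A ≥ β` over an interval of length `T`, then `∫ A² ≥ β² / T`, because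
`∫ A² - β² / T = ∫ (A - β / T)² + (2 β / T) (∫ A - β)`. -/
theorem posSemidef_intervalIntegral_mul_self_sub {n : Type*} [Fintype n] [DecidableEq n]
    {A : ℝ → Matrix n n ℝ} {β T t : ℝ} (hβ : 0 ≤ β) (hT : 0 < T)
    (hcont : ∀ i j, Continuous fun s => A s i j) (hA : ∀ s, (A s).IsHermitian)
    (h : ((Matrix.of fun i j => ∫ s in t..(t + T), A s i j) - β • (1 : Matrix n n ℝ)).PosSemidef) :
    ((Matrix.of fun i j => ∫ s in t..(t + T), (A s * A s) i j) -
      (β ^ 2 / T) • (1 : Matrix n n ℝ)).PosSemidef := by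
  have hexpand (s : ℝ) (i j : n) :
      ((A s - (β / T) • (1 : Matrix n n ℝ)) * (A s - (β / T) • (1 : Matrix n n ℝ))) i j =
        (A s * A s) i j - 2 * (β / T) * A s i j + (β / T) ^ 2 * (1 : Matrix n n ℝ) i j := by
    simp only [sub_mul, mul_sub, smul_mul_assoc, mul_smul_comm, one_mul, mul_one, Matrix.sub_apply,
      Matrix.smul_apply, smul_eq_mul]
    ring
  have hcontMul (i j : n) : Continuous fun s => (A s * A s) i j := by
    simp only [mul_apply]
    fun_prop
  have hsq := posSemidef_intervalIntegral (a := t) (b := t + T)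
    (A := fun s => (A s - (β / T) • (1 : Matrix n n ℝ)) * (A s - (β / T) • (1 : Matrix n n ℝ)))
    (by linarith) (fun i j => by simp only [hexpand]; fun_prop) fun s => by
      have hherm : (A s - (β / T) • (1 : Matrix n n ℝ)).IsHermitian :=
        (hA s).sub (by simp [IsHermitian])
      simpa only [hherm.eq] using
        posSemidef_conjTranspose_mul_self (A s - (β / T) • (1 : Matrix n n ℝ))
  convert hsq.add (h.smul (show 0 ≤ 2 * (β / T) by positivity)) using 1
  ext i j
  simp only [hexpand, Matrix.sub_apply, Matrix.add_apply, Matrix.smul_apply, of_apply, smul_eq_mul]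
  rw [intervalIntegral.integral_add (Continuous.intervalIntegrable (by fun_prop) _ _)
      (Continuous.intervalIntegrable (by fun_prop) _ _),
    intervalIntegral.integral_sub (Continuous.intervalIntegrable (by fun_prop) _ _)
      (Continuous.intervalIntegrable (by fun_prop) _ _),
    intervalIntegral.integral_const_mul, intervalIntegral.integral_const, smul_eq_mul]
  field_simp
  ring

/-- If `C ∈ PE(α,T)` then `C̄² ∈ PE(α²/(T N²), T)` where
`C̄(t) = (1/N) C(t)ᵀ C(t)`. -/
theorem averaged_regressor_squared_PE (p n : ℕ) (N α T : ℝ)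
    (hN : 0 < N) (hα : 0 < α) (hT : 0 < T)
    (C : ℝ → Matrix (Fin p) (Fin n) ℝ)
    (hcont : ∀ i j, Continuous fun t => C t i j)
    (hPE : IsPE C α T)
    (Cbar : ℝ → Matrix (Fin n) (Fin n) ℝ)
    (hCbar : ∀ t, Cbar t = N⁻¹ • ((C t)ᵀ * C t)) :
    ∀ t : ℝ, 0 ≤ t →
      Matrix.PosSemidef
        ((Matrix.of fun i j => ∫ τ in t..(t + T), (Cbar τ * Cbar τ) i j) -
          (α ^ 2 / (T * N ^ 2)) • (1 : Matrix (Fin n) (Fin n) ℝ)) := by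
  intro t ht
  have hconst : α ^ 2 / (T * N ^ 2) = (N⁻¹ * α) ^ 2 / T := by
    field_simp
  rw [hconst]
  refine posSemidef_intervalIntegral_mul_self_sub (by positivity) hT (fun i j => ?_)
    (fun s => ?_) ?_
  · simp only [hCbar, Matrix.smul_apply, mul_apply, transpose_apply]
    fun_prop
  · simp [hCbar, IsHermitian]
  · convert (hPE t ht).smul (inv_nonneg.2 hN.le) using 1
    ext i j
    simp [hCbar, mul_sub, mul_assoc]
end

section
/- Consider N agents communicating over a finite simple graph G on {1,…,N}, a consensus gain k > 0, a fixed parameter vector θ ∈ ℝⁿ, and for each agent i an entrywise continuous matrix function C'ᵢ : ℝ → ℝ^{n×n}, with local measurement y'ᵢ(t) = C'ᵢ(t) θ. Suppose X_i : ℝ → ℝ^{n×n} and x_i : ℝ → ℝⁿ are differentiable on [0,∞) and satisfy, for all t ≥ 0, the dynamic average consensus dynamics Ẋᵢ(t) = k Σ_{j ∈ N(i)} (Ĉᵢ(t) − Ĉⱼ(t)) and ẋᵢ(t) = k Σ_{j ∈ N(i)} (ŷᵢ(t) − ŷⱼ(t)), where Ĉᵢ(t) = C'ᵢ(t) − Xᵢ(t),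 ŷᵢ(t) = y'ᵢ(t) − xᵢ(t), and N(i) is the neighbor set of agent i in G. If Xᵢ(0) = 0 and xᵢ(0) = 0 for every i, then for all t ≥ 0 and every agent i, ŷᵢ(t) = Ĉᵢ(t) θ. -/
open Matrix

theorem eq_zero_of_hasDerivWithinAt_clm {E : Type*} [NormedAddCommGroup E] [NormedSpace ℝ E]
    (L : E →L[ℝ] E) {f : ℝ → E} {a : ℝ}
    (hf : ∀ t ≥ a, HasDerivWithinAt f (L (f t)) (Set.Ici a) t) (ha : f a = 0) :
    ∀ t ≥ a, f t = 0 := by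
  intro t ht
  refine ODE_solution_unique (v := fun _ => L) (g := fun _ => 0) (a := a) (b := t)
    (fun _ => L.lipschitz)
    (fun s hs => (hf s hs.1).continuousWithinAt.mono Set.Icc_subset_Ici_self)
    (fun s hs => (hf s hs.1).mono (Set.Ici_subset_Ici.2 hs.1))
    continuousOn_const (fun s _ => ?_) ha ⟨ht, le_rfl⟩
  simpa using hasDerivWithinAt_const s (Set.Ici s) (0 : E)

/-- (Regression invariance of dynamic average consensus.)
If the DAC states start at zero, then the consensus outputs satisfy
`ŷᵢ(t) = Ĉᵢ(t) θ` for all `t ≥ 0` and all agents `i`. -/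
theorem dac_regression_invariance (N n : ℕ) (G : SimpleGraph (Fin N))
    [DecidableRel G.Adj]
    (k : ℝ) (hk : 0 < k) (θ : Fin n → ℝ)
    (C' : Fin N → ℝ → Matrix (Fin n) (Fin n) ℝ)
    (hC'cont : ∀ i a b, Continuous fun t => C' i t a b)
    (y' : Fin N → ℝ → (Fin n → ℝ))
    (hy' : ∀ i t, y' i t = (C' i t).mulVec θ)
    (X : Fin N → ℝ → Matrix (Fin n) (Fin n) ℝ)
    (x : Fin N → ℝ → (Fin n → ℝ))
    (Chat : Fin N → ℝ → Matrix (Fin n) (Fin n) ℝ)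
    (hChat : ∀ i t, Chat i t = C' i t - X i t)
    (yhat : Fin N → ℝ → (Fin n → ℝ))
    (hyhat : ∀ i t, yhat i t = y' i t - x i t)
    (hX : ∀ i, ∀ t ≥ (0 : ℝ), ∀ a b,
      HasDerivWithinAt (fun s => X i s a b)
        (k * ∑ j ∈ G.neighborFinset i, (Chat i t a b - Chat j t a b))
        (Set.Ici 0) t)
    (hx : ∀ i, ∀ t ≥ (0 : ℝ),
      HasDerivWithinAt (fun s => x i s)
        (k • ∑ j ∈ G.neighborFinset i, (yhat i t - yhat j t))
        (Set.Ici 0) t)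
    (hX0 : ∀ i, X i 0 = 0) (hx0 : ∀ i, x i 0 = 0) :
    ∀ t ≥ (0 : ℝ), ∀ i, yhat i t = (Chat i t).mulVec θ := by
  have hyC : ∀ i t, yhat i t - (Chat i t).mulVec θ = -(x i t - (X i t).mulVec θ) := by
    intro i t
    rw [hyhat, hy', hChat, Matrix.sub_mulVec]
    abel
  let L : (Fin N → Fin n → ℝ) →L[ℝ] (Fin N → Fin n → ℝ) :=
    ContinuousLinearMap.pi fun i => k • ∑ j ∈ G.neighborFinset i,
      (ContinuousLinearMap.proj (R := ℝ) (φ := fun _ : Fin N => Fin n → ℝ) j -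
        ContinuousLinearMap.proj i)
  have hzero := eq_zero_of_hasDerivWithinAt_clm L (a := 0)
    (f := fun t i => x i t - (X i t).mulVec θ) ?_ ?_
  · intro t ht i
    rw [← sub_eq_zero, hyC, neg_eq_zero]
    exact congrFun (hzero t ht) i
  · intro t ht
    refine hasDerivWithinAt_pi.2 fun i => hasDerivWithinAt_pi.2 fun a => ?_
    have hXθ : HasDerivWithinAt (fun s => (X i s).mulVec θ a)
        (∑ b, k * (∑ j ∈ G.neighborFinset i, (Chat i t a b - Chat j t a b)) * θ b)
        (Set.Ici 0) t := by
      simp only [Matrix.mulVec, dotProduct]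
      exact HasDerivWithinAt.fun_sum fun b _ => (hX i t ht a b).mul_const (θ b)
    refine ((hasDerivWithinAt_pi.1 (hx i t ht) a).sub hXθ).congr_deriv ?_
    have hsum : ∑ b, k * (∑ j ∈ G.neighborFinset i, (Chat i t a b - Chat j t a b)) * θ b =
        k * ∑ j ∈ G.neighborFinset i, ((Chat i t).mulVec θ a - (Chat j t).mulVec θ a) := by
      simp only [Matrix.mulVec, dotProduct, ← Finset.sum_sub_distrib, ← sub_mul]
      rw [Finset.sum_comm, Finset.mul_sum]
      exact Finset.sum_congr rfl fun b _ => by rw [mul_assoc, Finset.sum_mul]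
    rw [hsum]
    simp only [L, ContinuousLinearMap.pi_apply, _root_.smul_apply,
      _root_.sum_apply, _root_.sub_apply,
      ContinuousLinearMap.proj_apply, Pi.smul_apply, Finset.sum_apply, Pi.sub_apply, smul_eq_mul]
    rw [← mul_sub, ← Finset.sum_sub_distrib]
    congr 1
    refine Finset.sum_congr rfl fun j _ => ?_
    have hi := congrFun (hyC i t) a
    have hj := congrFun (hyC j t) a
    simp only [Pi.sub_apply, Pi.neg_apply] at hi hj
    linarith
  · funext i
    simp [hX0, hx0]
end

section
/- Let A, B : ℝ → ℝ^{n×n} be entrywise continuous functions taking symmetric matrix values, let T, β, b > 0 and c ∈ ℝ. Assume that for all t ≥ 0 the operator norms satisfy ‖A(t)‖ ≤ β and ‖B(t)‖ ≤ b, and that for all t ≥ 0 the matrix ∫_t^{t+T} A(τ)² dτ − c·Iₙ is positive semidefinite. Then for all t ≥ 0, the matrix ∫_t^{t+T} (A(τ)+B(τ))² dτ − (c − 2 β b T)·Iₙ is positive semidefinite. In particular, if c > 2 β b T, the perturbed function A + B has ∫_t^{t+T}(A+B)² bounded below by a positive multiple of the identity uniformly in t. -/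
open Matrix MeasureTheory

/-- The Euclidean norm of a finitely-indexed real vector. -/
noncomputable def euclNorm {ι : Type*} [Fintype ι] (v : ι → ℝ) : ℝ :=
  Real.sqrt (∑ i, v i ^ 2)

lemma euclNorm_nonneg {ι : Type*} [Fintype ι] (v : ι → ℝ) : 0 ≤ euclNorm v :=
  Real.sqrt_nonneg _

lemma euclNorm_sq {ι : Type*} [Fintype ι] (v : ι → ℝ) : euclNorm v ^ 2 = v ⬝ᵥ v := by
  rw [euclNorm, Real.sq_sqrt (Finset.sum_nonneg fun i _ => sq_nonneg (v i))]
  simp [dotProduct, sq]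

lemma dotProduct_le_euclNorm_mul {ι : Type*} [Fintype ι] (v w : ι → ℝ) :
    v ⬝ᵥ w ≤ euclNorm v * euclNorm w :=
  Real.sum_mul_le_sqrt_mul_sqrt _ v w

lemma Matrix.IsSymm.dotProduct_mul_self_mulVec {ι : Type*} [Fintype ι] {M : Matrix ι ι ℝ}
    (hM : M.IsSymm) (v : ι → ℝ) : v ⬝ᵥ (M * M) *ᵥ v = M *ᵥ v ⬝ᵥ M *ᵥ v := by
  rw [← mulVec_mulVec, dotProduct_mulVec, ← mulVec_transpose, hM.eq]

lemma dotProduct_integral_mulVec {ι : Type*} [Fintype ι] {M : ℝ → Matrix ι ι ℝ}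
    (hM : ∀ i j, Continuous fun t => M t i j) (a b : ℝ) (v : ι → ℝ) :
    v ⬝ᵥ (Matrix.of fun i j => ∫ τ in a..b, M τ i j) *ᵥ v = ∫ τ in a..b, v ⬝ᵥ M τ *ᵥ v := by
  simp only [dotProduct, mulVec, Matrix.of_apply]
  rw [intervalIntegral.integral_finsetSum fun i _ =>
    Continuous.intervalIntegrable (by fun_prop) a b]
  refine Finset.sum_congr rfl fun i _ => ?_
  rw [intervalIntegral.integral_const_mul, intervalIntegral.integral_finsetSum fun j _ =>
    Continuous.intervalIntegrable (by fun_prop) a b]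
  simp only [intervalIntegral.integral_mul_const]

lemma continuous_mul_apply {ι : Type*} [Fintype ι] {M N : ℝ → Matrix ι ι ℝ}
    (hM : ∀ i j, Continuous fun t => M t i j) (hN : ∀ i j, Continuous fun t => N t i j)
    (i j : ι) : Continuous fun t => (M t * N t) i j := by
  simp only [Matrix.mul_apply]
  fun_prop

lemma continuous_dotProduct_mulVec {ι : Type*} [Fintype ι] {M : ℝ → Matrix ι ι ℝ}
    (hM : ∀ i j, Continuous fun t => M t i j) (v : ι → ℝ) :
    Continuous fun t => v ⬝ᵥ M t *ᵥ v := by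
  simp only [dotProduct, mulVec]
  fun_prop

lemma dotProduct_sq_add_mulVec_ge {ι : Type*} [Fintype ι] {M N : Matrix ι ι ℝ} {β b : ℝ}
    (hM : M.IsSymm) (hN : N.IsSymm) {v : ι → ℝ}
    (hMβ : euclNorm (M *ᵥ v) ≤ β * euclNorm v) (hNb : euclNorm (N *ᵥ v) ≤ b * euclNorm v) :
    v ⬝ᵥ (M * M) *ᵥ v - 2 * β * b * (v ⬝ᵥ v) ≤ v ⬝ᵥ ((M + N) * (M + N)) *ᵥ v := by
  rw [hM.dotProduct_mul_self_mulVec, (hM.add hN).dotProduct_mul_self_mulVec, add_mulVec]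
  have hcross := dotProduct_le_euclNorm_mul (-(M *ᵥ v)) (N *ᵥ v)
  have hneg : euclNorm (-(M *ᵥ v)) = euclNorm (M *ᵥ v) := by simp [euclNorm]
  have hprod := mul_le_mul hMβ hNb (euclNorm_nonneg _) ((euclNorm_nonneg _).trans hMβ)
  have hNN := (euclNorm_sq (N *ᵥ v)).symm.trans_ge (sq_nonneg _)
  rw [hneg, neg_dotProduct] at hcross
  rw [← euclNorm_sq v, add_dotProduct, dotProduct_add, dotProduct_add,
    dotProduct_comm (N *ᵥ v) (M *ᵥ v)]
  linarith

/-- If `‖A(t)‖ ≤ β`, `‖B(t)‖ ≤ b` (operator norms induced by the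
Euclidean norm) and `∫_t^{t+T} A(τ)² dτ − c·Iₙ ⪰ 0` for all `t ≥ 0`, then
`∫_t^{t+T} (A(τ)+B(τ))² dτ − (c − 2βbT)·Iₙ ⪰ 0` for all `t ≥ 0`. -/
theorem integral_sq_psd_perturbation (n : ℕ) (T β b c : ℝ)
    (hT : 0 < T) (hβ : 0 < β) (hb : 0 < b)
    (A B : ℝ → Matrix (Fin n) (Fin n) ℝ)
    (hAcont : ∀ i j, Continuous fun t => A t i j)
    (hBcont : ∀ i j, Continuous fun t => B t i j)
    (hAsymm : ∀ t, (A t).IsSymm) (hBsymm : ∀ t, (B t).IsSymm)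
    (hAnorm : ∀ t ≥ (0 : ℝ), ∀ v : Fin n → ℝ,
      euclNorm ((A t).mulVec v) ≤ β * euclNorm v)
    (hBnorm : ∀ t ≥ (0 : ℝ), ∀ v : Fin n → ℝ,
      euclNorm ((B t).mulVec v) ≤ b * euclNorm v)
    (hA : ∀ t ≥ (0 : ℝ), Matrix.PosSemidef
      ((Matrix.of fun i j => ∫ τ in t..(t + T), (A τ * A τ) i j) -
        c • (1 : Matrix (Fin n) (Fin n) ℝ))) :
    ∀ t ≥ (0 : ℝ), Matrix.PosSemidef
      ((Matrix.of fun i j => ∫ τ in t..(t + T), ((A τ + B τ) * (A τ + B τ)) i j) -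
        (c - 2 * β * b * T) • (1 : Matrix (Fin n) (Fin n) ℝ)) := by
  intro t ht
  have hABsymm τ : (A τ + B τ).IsSymm := (hAsymm τ).add (hBsymm τ)
  have hABcont i j : Continuous fun τ => (A τ + B τ) i j := (hAcont i j).add (hBcont i j)
  have hAAcont := continuous_mul_apply hAcont hAcont
  have hSScont := continuous_mul_apply hABcont hABcont
  refine PosSemidef.of_dotProduct_mulVec_nonneg ?_ fun v => ?_
  · refine IsHermitian.sub ?_ (by simp [IsHermitian])
    ext i j
    have hsymm τ : ((A τ + B τ) * (A τ + B τ)) j i = ((A τ + B τ) * (A τ + B τ)) i j := by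
      rw [← transpose_apply ((A τ + B τ) * (A τ + B τ)) i j, transpose_mul, (hABsymm τ).eq]
    simp [hsymm]
  · have hAv := (hA t ht).dotProduct_mulVec_nonneg v
    simp only [star_trivial, sub_mulVec, smul_mulVec, one_mulVec, dotProduct_sub,
      dotProduct_smul, smul_eq_mul] at hAv ⊢
    rw [dotProduct_integral_mulVec hAAcont] at hAv
    rw [dotProduct_integral_mulVec hSScont]
    have hAAint := (continuous_dotProduct_mulVec hAAcont v).intervalIntegrable t (t + T)
      (μ := volume)
    have hle := intervalIntegral.integral_mono_on (by linarith : t ≤ t + T)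
      (hAAint.sub intervalIntegrable_const)
      ((continuous_dotProduct_mulVec hSScont v).intervalIntegrable t (t + T) (μ := volume))
      fun τ hτ => dotProduct_sq_add_mulVec_ge (hAsymm τ) (hBsymm τ)
        (hAnorm τ (ht.le.trans hτ.1) v) (hBnorm τ (ht.le.trans hτ.1) v)
    rw [intervalIntegral.integral_sub hAAint intervalIntegrable_const,
      intervalIntegral.integral_const, smul_eq_mul] at hle
    linarith
end

section
/- Consider N agents on a connected finite simple graph G on {1,…,N} with Laplacian L and constant λ_G > 0 such that vᵀ L v ≥ λ_G ‖v‖² for every v ∈ ℝ^N with 1ᵀv = 0, and a consensus gain k > 0. For each agent i let C'ᵢ : ℝ → ℝ^{n×n} be continuously differentiable, set C̄(t) = (1/N) Σⱼ C'ⱼ(t), and assume the stacked deviation matrix D(t) ∈ ℝ^{Nn×n}, whose i-th n×n block is d/dt C'ᵢ(t) − (1/N) Σⱼ d/dt C'ⱼ(t), satisfies ‖D(t)‖ ≤ γ for all t ≥ 0 (operator norm). Suppose Xᵢ : ℝ → ℝ^{n×n} are differentiable with Xᵢ(0) = 0 and Ẋᵢ(t) = k Σ_{j∈N(i)} (Ĉᵢ(t)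 − Ĉⱼ(t)) for all t ≥ 0, where Ĉᵢ(t) = C'ᵢ(t) − Xᵢ(t), and let the consensus error be C̃ᵢ(t) = Ĉᵢ(t) − C̄(t). Then for every ρ > n γ / (k λ_G) there exists a finite time T_ρ ≥ 0 (depending on the initial data) such that for all t ≥ T_ρ and all agents i, the Frobenius norm satisfies ‖C̃ᵢ(t)‖_F ≤ ρ. -/
open Matrix

/-- The Frobenius norm of a real matrix. -/
noncomputable def frobNorm {m n : ℕ} (M : Matrix (Fin m) (Fin n) ℝ) : ℝ :=
  Real.sqrt (∑ a, ∑ b, M a b ^ 2)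

/-- A nonnegative-time differential inequality `V' ≤ -α V + α B` forces `V` to be eventually
below every level above `B`. -/
theorem eventually_le_of_hasDerivWithinAt_le {V V' : ℝ → ℝ} {α B : ℝ} (hα : 0 < α)
    (hV : ∀ t ≥ (0 : ℝ), HasDerivWithinAt V (V' t) (Set.Ici 0) t)
    (hV' : ∀ t ≥ (0 : ℝ), V' t ≤ -α * V t + α * B) {R : ℝ} (hR : B < R) :
    ∃ T ≥ (0 : ℝ), ∀ t ≥ T, V t ≤ R := by
  have hW : ∀ t ≥ (0 : ℝ), HasDerivWithinAt (fun s => Real.exp (α * s) * (V s - B))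
      (Real.exp (α * t) * (α * 1) * (V t - B) + Real.exp (α * t) * V' t) (Set.Ici 0) t := by
    intro t ht
    exact (((hasDerivAt_id t).const_mul α).exp.hasDerivWithinAt).mul ((hV t ht).sub_const B)
  have hanti : AntitoneOn (fun s => Real.exp (α * s) * (V s - B)) (Set.Ici 0) := by
    refine antitoneOn_of_hasDerivWithinAt_nonpos (convex_Ici 0)
      (fun t ht => (hW t ht).continuousWithinAt)
      (fun t ht => (hW t (interior_subset ht)).mono interior_subset) ?_
    intro t ht
    have h := hV' t (interior_subset ht)
    nlinarith [Real.exp_pos (α * t)]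
  have hlim : Filter.Tendsto (fun t => Real.exp (-(α * t)) * (V 0 - B) + B) Filter.atTop
      (nhds (0 * (V 0 - B) + B)) := by
    refine (Filter.Tendsto.mul_const _ ?_).add_const _
    exact Real.tendsto_exp_neg_atTop_nhds_zero.comp
      (Filter.tendsto_id.const_mul_atTop hα)
  obtain ⟨T, hT⟩ := Filter.eventually_atTop.mp
    (hlim.eventually_lt_const (show 0 * (V 0 - B) + B < R by linarith))
  refine ⟨max T 0, le_max_right _ _, fun t ht => ?_⟩
  have h1 := hT t (le_trans (le_max_left _ _) ht)
  have ht0 : (0 : ℝ) ≤ t := le_trans (le_max_right _ _) ht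
  have h2 := hanti (Set.mem_Ici.mpr le_rfl) ht0 ht0
  simp only [mul_zero, Real.exp_zero, one_mul] at h2
  have h3 := mul_le_mul_of_nonneg_left h2 (Real.exp_pos (-(α * t))).le
  rw [← mul_assoc, ← Real.exp_add, neg_add_cancel, Real.exp_zero, one_mul] at h3
  linarith

/-- The sum of squared entries of a matrix with `n` columns and operator norm at most `γ`
is at most `n γ²`. -/
theorem sum_sq_le_of_euclNorm_mulVec_le {ι : Type*} [Fintype ι] {n : ℕ}
    (M : Matrix ι (Fin n) ℝ) {γ : ℝ}
    (hM : ∀ v : Fin n → ℝ, euclNorm (M.mulVec v) ≤ γ * euclNorm v) :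
    ∑ b, ∑ p, M p b ^ 2 ≤ n * γ ^ 2 := by
  have hcol : ∀ b, ∑ p, M p b ^ 2 ≤ γ ^ 2 := by
    intro b
    have h := hM (Pi.single b 1)
    have h1 : euclNorm (Pi.single b 1 : Fin n → ℝ) = 1 := by
      simp [euclNorm, Pi.single_apply]
    rw [h1, mul_one, mulVec_single_one] at h
    exact (Real.sqrt_le_left ((Real.sqrt_nonneg _).trans h)).mp h
  calc ∑ b, ∑ p, M p b ^ 2 ≤ ∑ _b : Fin n, γ ^ 2 := Finset.sum_le_sum fun b _ => hcol b
    _ = n * γ ^ 2 := by simp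

/-- Dissipation estimate for one coordinate of a perturbed Laplacian flow `c' = d - k L c`
on the consensus-error subspace. -/
theorem sum_mul_sub_lapMatrix_mulVec_le {ι : Type*} [Fintype ι] [DecidableEq ι]
    (G : SimpleGraph ι) [DecidableRel G.Adj] {lamG k : ℝ} (hlamG : 0 < lamG) (hk : 0 < k)
    (c d : ι → ℝ)
    (hc : lamG * (∑ i, c i ^ 2) ≤ c ⬝ᵥ ((G.lapMatrix ℝ).mulVec c)) :
    ∑ i, 2 * c i * (d i - k * ((G.lapMatrix ℝ).mulVec c) i) ≤
      -(k * lamG) * ∑ i, c i ^ 2 + (k * lamG)⁻¹ * ∑ i, d i ^ 2 := by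
  have hα : 0 < k * lamG := mul_pos hk hlamG
  have hyoung : ∀ i, 2 * c i * d i ≤ k * lamG * c i ^ 2 + (k * lamG)⁻¹ * d i ^ 2 := by
    intro i
    have h : k * lamG * c i ^ 2 + (k * lamG)⁻¹ * d i ^ 2 - 2 * c i * d i =
        (k * lamG)⁻¹ * (k * lamG * c i - d i) ^ 2 := by
      field_simp
      ring
    have := mul_nonneg (inv_pos.mpr hα).le (sq_nonneg (k * lamG * c i - d i))
    linarith
  have hsum : ∑ i, 2 * c i * d i ≤
      k * lamG * ∑ i, c i ^ 2 + (k * lamG)⁻¹ * ∑ i, d i ^ 2 := by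
    rw [Finset.mul_sum, Finset.mul_sum, ← Finset.sum_add_distrib]
    exact Finset.sum_le_sum fun i _ => hyoung i
  have hsplit : ∑ i, 2 * c i * (d i - k * ((G.lapMatrix ℝ).mulVec c) i) =
      ∑ i, 2 * c i * d i - 2 * k * (c ⬝ᵥ ((G.lapMatrix ℝ).mulVec c)) := by
    rw [dotProduct, Finset.mul_sum, ← Finset.sum_sub_distrib]
    exact Finset.sum_congr rfl fun i _ => by ring
  have := mul_le_mul_of_nonneg_left hc hk.le
  rw [hsplit]
  linarith

/-- Neighbor differences sum to zero over all vertices. -/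
theorem sum_lapMatrix_mulVec {ι : Type*} [Fintype ι] [DecidableEq ι]
    (G : SimpleGraph ι) [DecidableRel G.Adj] (c : ι → ℝ) :
    ∑ i, ((G.lapMatrix ℝ).mulVec c) i = 0 := by
  have h : (fun _ : ι => (1 : ℝ)) ⬝ᵥ (G.lapMatrix ℝ).mulVec c = 0 := by
    rw [dotProduct_mulVec, ← mulVec_transpose, (G.isSymm_lapMatrix (R := ℝ)).eq,
      SimpleGraph.lapMatrix_mulVec_const_eq_zero, zero_dotProduct]
  simpa [dotProduct] using h

theorem sum_neighborFinset_sub {ι : Type*} [Fintype ι] [DecidableEq ι]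
    (G : SimpleGraph ι) [DecidableRel G.Adj] (c : ι → ℝ) (i : ι) :
    ∑ j ∈ G.neighborFinset i, (c i - c j) = ((G.lapMatrix ℝ).mulVec c) i := by
  rw [SimpleGraph.lapMatrix_mulVec_apply, Finset.sum_sub_distrib]
  simp

/-- (Ultimate bound on the consensus error.)
Under the DAC dynamics with zero initial states and bounded stacked deviation of
the regressor derivatives, for every `ρ > n γ / (k λ_G)` the Frobenius norm of
every agent's consensus error `C̃ᵢ(t) = Ĉᵢ(t) − C̄(t)` eventually stays below `ρ`. -/
theorem consensus_error_ultimate_bound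
    (N n : ℕ) (G : SimpleGraph (Fin N)) [DecidableRel G.Adj]
    (hconn : G.Connected)
    (lamG k γ : ℝ) (hlamG : 0 < lamG) (hk : 0 < k)
    (hLap : ∀ v : Fin N → ℝ, (∑ i, v i) = 0 →
      lamG * (∑ i, v i ^ 2) ≤ v ⬝ᵥ ((G.lapMatrix ℝ).mulVec v))
    (C' Cd : Fin N → ℝ → Matrix (Fin n) (Fin n) ℝ)
    (hderiv : ∀ i a b t, HasDerivAt (fun s => C' i s a b) (Cd i t a b) t)
    (hCdcont : ∀ i a b, Continuous fun t => Cd i t a b)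
    (D : ℝ → Matrix (Fin N × Fin n) (Fin n) ℝ)
    (hD : ∀ t i a b, D t (i, a) b = Cd i t a b - (N : ℝ)⁻¹ * ∑ j, Cd j t a b)
    (hγ : ∀ t ≥ (0 : ℝ), ∀ v : Fin n → ℝ,
      euclNorm ((D t).mulVec v) ≤ γ * euclNorm v)
    (X : Fin N → ℝ → Matrix (Fin n) (Fin n) ℝ)
    (Chat : Fin N → ℝ → Matrix (Fin n) (Fin n) ℝ)
    (hChat : ∀ i t, Chat i t = C' i t - X i t)
    (hX : ∀ i, ∀ t ≥ (0 : ℝ), ∀ a b,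
      HasDerivWithinAt (fun s => X i s a b)
        (k * ∑ j ∈ G.neighborFinset i, (Chat i t a b - Chat j t a b))
        (Set.Ici 0) t)
    (hX0 : ∀ i, X i 0 = 0)
    (Cbar : ℝ → Matrix (Fin n) (Fin n) ℝ)
    (hCbar : ∀ t, Cbar t = (N : ℝ)⁻¹ • ∑ j, C' j t)
    (Ctil : Fin N → ℝ → Matrix (Fin n) (Fin n) ℝ)
    (hCtil : ∀ i t, Ctil i t = Chat i t - Cbar t) :
    ∀ ρ > n * γ / (k * lamG), ∃ Tρ ≥ (0 : ℝ), ∀ t ≥ Tρ, ∀ i : Fin N,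
      frobNorm (Ctil i t) ≤ ρ := by
  intro ρ hρ
  have hα : 0 < k * lamG := mul_pos hk hlamG
  have hN : (N : ℝ) ≠ 0 := by
    obtain ⟨i⟩ := hconn.nonempty
    exact Nat.cast_ne_zero.mpr (by have := i.2; omega)
  have hCtil_apply : ∀ i t a b,
      Ctil i t a b = C' i t a b - X i t a b - (N : ℝ)⁻¹ * ∑ j, C' j t a b := by
    intro i t a b
    simp [hCtil, hChat, hCbar, Matrix.sum_apply]
  have hX' : ∀ i, ∀ t ≥ (0 : ℝ), ∀ a b, HasDerivWithinAt (fun s => X i s a b)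
      (k * ((G.lapMatrix ℝ).mulVec fun j => Ctil j t a b) i) (Set.Ici 0) t := by
    intro i t ht a b
    have h := hX i t ht a b
    rw [← sum_neighborFinset_sub]
    simpa [hCtil] using h
  have hXsum : ∀ t ≥ (0 : ℝ), ∀ a b, ∑ i, X i t a b = 0 := by
    intro t ht a b
    have hd : ∀ s ≥ (0 : ℝ),
        HasDerivWithinAt (fun s => ∑ i, X i s a b) 0 (Set.Ici 0) s := by
      intro s hs
      have h := HasDerivWithinAt.fun_sum (u := Finset.univ) fun i _ => hX' i s hs a b
      rwa [← Finset.mul_sum, sum_lapMatrix_mulVec, mul_zero] at h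
    have h := constant_of_has_deriv_right_zero (a := 0) (b := t)
      (fun s hs => (hd s hs.1).continuousWithinAt.mono Set.Icc_subset_Ici_self)
      (fun s hs => (hd s hs.1).mono (Set.Ici_subset_Ici.mpr hs.1)) t ⟨ht, le_rfl⟩
    simpa [hX0] using h
  have hCsum : ∀ t ≥ (0 : ℝ), ∀ a b, ∑ i, Ctil i t a b = 0 := by
    intro t ht a b
    simp only [hCtil_apply, Finset.sum_sub_distrib, hXsum t ht a b]
    simp [hN]
  have hCderiv : ∀ i, ∀ t ≥ (0 : ℝ), ∀ a b, HasDerivWithinAt (fun s => Ctil i s a b)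
      (D t (i, a) b - k * ((G.lapMatrix ℝ).mulVec fun j => Ctil j t a b) i)
      (Set.Ici 0) t := by
    intro i t ht a b
    have h := (((hderiv i a b t).hasDerivWithinAt (s := Set.Ici 0)).sub (hX' i t ht a b)).sub
      ((HasDerivWithinAt.fun_sum (u := Finset.univ) fun j _ =>
        (hderiv j a b t).hasDerivWithinAt (s := Set.Ici 0)).const_mul (N : ℝ)⁻¹)
    rw [hD, sub_right_comm]
    exact h.congr_of_eventuallyEq (.of_forall fun s => hCtil_apply i s a b)
      (hCtil_apply i t a b)
  have hV : ∀ t ≥ (0 : ℝ), HasDerivWithinAt (fun s => ∑ a, ∑ b, ∑ i, Ctil i s a b ^ 2)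
      (∑ a, ∑ b, ∑ i, 2 * Ctil i t a b *
        (D t (i, a) b - k * ((G.lapMatrix ℝ).mulVec fun j => Ctil j t a b) i))
      (Set.Ici 0) t := by
    intro t ht
    refine HasDerivWithinAt.fun_sum fun a _ => HasDerivWithinAt.fun_sum fun b _ =>
      HasDerivWithinAt.fun_sum fun i _ => ?_
    simpa using (hCderiv i t ht a b).fun_pow 2
  have hVle : ∀ t ≥ (0 : ℝ), ∑ a, ∑ b, ∑ i, 2 * Ctil i t a b *
        (D t (i, a) b - k * ((G.lapMatrix ℝ).mulVec fun j => Ctil j t a b) i) ≤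
      -(k * lamG) * (∑ a, ∑ b, ∑ i, Ctil i t a b ^ 2) +
        (k * lamG) * (n * γ ^ 2 / (k * lamG) ^ 2) := by
    intro t ht
    have hDsum : ∑ a, ∑ b, ∑ i, D t (i, a) b ^ 2 ≤ n * γ ^ 2 := by
      refine le_trans (le_of_eq ?_) (sum_sq_le_of_euclNorm_mulVec_le (D t) (hγ t ht))
      rw [Finset.sum_comm]
      exact Finset.sum_congr rfl fun b _ => by rw [Fintype.sum_prod_type_right]
    calc _ ≤ ∑ a, ∑ b, (-(k * lamG) * (∑ i, Ctil i t a b ^ 2) +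
          (k * lamG)⁻¹ * ∑ i, D t (i, a) b ^ 2) :=
        Finset.sum_le_sum fun a _ => Finset.sum_le_sum fun b _ =>
          sum_mul_sub_lapMatrix_mulVec_le G hlamG hk (fun i => Ctil i t a b)
            (fun i => D t (i, a) b) (hLap _ (hCsum t ht a b))
      _ = -(k * lamG) * (∑ a, ∑ b, ∑ i, Ctil i t a b ^ 2) +
          (k * lamG)⁻¹ * ∑ a, ∑ b, ∑ i, D t (i, a) b ^ 2 := by
        simp only [Finset.sum_add_distrib, Finset.mul_sum]
      _ ≤ -(k * lamG) * (∑ a, ∑ b, ∑ i, Ctil i t a b ^ 2) +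
          (k * lamG)⁻¹ * (n * γ ^ 2) := by gcongr
      _ = _ := by field_simp
  have hnγ : 0 ≤ n * γ := by
    rcases Nat.eq_zero_or_pos n with rfl | hn
    · simp
    · have h := hγ 0 le_rfl (Pi.single ⟨0, hn⟩ 1)
      have h1 : euclNorm (Pi.single ⟨0, hn⟩ 1 : Fin n → ℝ) = 1 := by
        simp [euclNorm, Pi.single_apply]
      rw [h1, mul_one] at h
      exact mul_nonneg n.cast_nonneg ((Real.sqrt_nonneg _).trans h)
  have hρ0 : 0 ≤ n * γ / (k * lamG) := div_nonneg hnγ hα.le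
  have hB : n * γ ^ 2 / (k * lamG) ^ 2 < ρ ^ 2 := by
    have hn2 : (n : ℝ) ≤ (n : ℝ) ^ 2 := by exact_mod_cast Nat.le_self_pow two_ne_zero n
    calc n * γ ^ 2 / (k * lamG) ^ 2 ≤ (n : ℝ) ^ 2 * γ ^ 2 / (k * lamG) ^ 2 := by gcongr
      _ = (n * γ / (k * lamG)) ^ 2 := by rw [div_pow, mul_pow (n : ℝ) γ]
      _ < ρ ^ 2 := pow_lt_pow_left₀ hρ hρ0 two_ne_zero
  obtain ⟨T, hT0, hT⟩ := eventually_le_of_hasDerivWithinAt_le hα hV hVle hB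
  refine ⟨T, hT0, fun t ht i => ?_⟩
  refine (Real.sqrt_le_left (hρ0.trans hρ.le)).mpr (le_trans ?_ (hT t ht))
  exact Finset.sum_le_sum fun a _ => Finset.sum_le_sum fun b _ =>
    Finset.single_le_sum (f := fun i => Ctil i t a b ^ 2) (fun j _ => sq_nonneg _)
      (Finset.mem_univ i)
end

section
/- Let φ : ℝ → ℝ be continuous with φ ∉ L², i.e. ∫₀ᵗ φ(τ)² dτ → ∞ as t → ∞. Let Γ = diag(γ₁,…,γₙ) with γ_μ > 0 for every μ, and let θ̃ : [0,∞) → ℝⁿ be differentiable with θ̃'(t) = −Γ φ(t)² θ̃(t) for all t ≥ 0. Then θ̃(t) → 0 as t → ∞; equivalently, the DREM estimate θ̂(t) = θ̃(t) + θ converges to the true parameter θ. Moreover each component satisfies θ̃_μ(t) = θ̃_μ(0) exp(−γ_μ ∫₀ᵗ φ(τ)² dτ), so ‖θ̃(t)‖ is nonincreasing. -/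
open MeasureTheory Filter

/-- A solution of the scalar linear equation `x' = c a(t) x` on `[0, ∞)` with continuous `a`
is `x 0 * exp (c ∫₀ᵗ a)`. -/
theorem eq_mul_exp_integral_of_hasDerivWithinAt {a x : ℝ → ℝ} {c : ℝ} (ha : Continuous a)
    (hx : ∀ t ≥ (0 : ℝ), HasDerivWithinAt x (c * a t * x t) (Set.Ici 0) t)
    {t : ℝ} (ht : 0 ≤ t) :
    x t = x 0 * Real.exp (c * ∫ τ in (0 : ℝ)..t, a τ) := by
  have hd : ∀ s ≥ (0 : ℝ), HasDerivWithinAt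
      (fun s => x s * Real.exp (-(c * ∫ τ in (0 : ℝ)..s, a τ))) 0 (Set.Ici 0) s := by
    intro s hs
    have hI := (ha.integral_hasStrictDerivAt 0 s).hasDerivAt
    refine ((hx s hs).fun_mul (hI.const_mul c).fun_neg.exp.hasDerivWithinAt).congr_deriv ?_
    ring
  have hconst := constant_of_has_deriv_right_zero
    (fun s hs => (hd s hs.1).continuousWithinAt.mono Set.Icc_subset_Ici_self)
    (fun s hs => (hd s hs.1).mono (Set.Ici_subset_Ici.mpr hs.1)) t (Set.right_mem_Icc.mpr ht)
  simp only [intervalIntegral.integral_same, mul_zero, neg_zero, Real.exp_zero,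
    mul_one] at hconst
  rw [← hconst, mul_assoc, ← Real.exp_add, neg_add_cancel, Real.exp_zero, mul_one]

/-- The Euclidean norm is monotone in the absolute values of the coordinates. -/
theorem euclNorm_le_euclNorm {ι : Type*} [Fintype ι] {v w : ι → ℝ} (h : ∀ i, |v i| ≤ |w i|) :
    euclNorm v ≤ euclNorm w :=
  Real.sqrt_le_sqrt (Finset.sum_le_sum fun i _ => sq_le_sq.mpr (h i))

/-- (DREM convergence under the non-`L²` condition.)
If `∫₀ᵗ φ² → ∞` and `θ̃' = −Γ φ(t)² θ̃` with `Γ = diag(γ₁,…,γₙ)`, `γ_μ > 0`, then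
`θ̃(t) → 0`, each component satisfies the closed-form exponential formula, and
`‖θ̃(t)‖` is nonincreasing on `[0, ∞)`. -/
theorem drem_convergence (n : ℕ) (φ : ℝ → ℝ) (hφ : Continuous φ)
    (hL2 : Tendsto (fun t => ∫ τ in (0 : ℝ)..t, (φ τ) ^ 2) atTop atTop)
    (γ : Fin n → ℝ) (hγ : ∀ μ, 0 < γ μ)
    (θtil : ℝ → (Fin n → ℝ))
    (hdyn : ∀ t ≥ (0 : ℝ), ∀ μ : Fin n,
      HasDerivWithinAt (fun s => θtil s μ) (-(γ μ) * (φ t) ^ 2 * θtil t μ)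
        (Set.Ici 0) t) :
    Tendsto θtil atTop (nhds 0) ∧
    (∀ t ≥ (0 : ℝ), ∀ μ : Fin n,
      θtil t μ = θtil 0 μ * Real.exp (-(γ μ) * ∫ τ in (0 : ℝ)..t, (φ τ) ^ 2)) ∧
    (∀ s t : ℝ, 0 ≤ s → s ≤ t → euclNorm (θtil t) ≤ euclNorm (θtil s)) := by
  have hsol : ∀ t ≥ (0 : ℝ), ∀ μ : Fin n,
      θtil t μ = θtil 0 μ * Real.exp (-(γ μ) * ∫ τ in (0 : ℝ)..t, (φ τ) ^ 2) :=
    fun t ht μ => eq_mul_exp_integral_of_hasDerivWithinAt (x := fun s => θtil s μ) (hφ.pow 2)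
      (fun s hs => hdyn s hs μ) ht
  refine ⟨tendsto_pi_nhds.mpr fun μ => ?_, hsol, fun s t hs hst => ?_⟩
  · have hexp := (Real.tendsto_exp_atBot.comp
      (hL2.const_mul_atTop_of_neg (neg_lt_zero.mpr (hγ μ)))).const_mul (θtil 0 μ)
    rw [mul_zero] at hexp
    refine hexp.congr' ?_
    filter_upwards [eventually_ge_atTop (0 : ℝ)] with t ht using (hsol t ht μ).symm
  · refine euclNorm_le_euclNorm fun μ => ?_
    have hmono : ∫ τ in (0 : ℝ)..s, (φ τ) ^ 2 ≤ ∫ τ in (0 : ℝ)..t, (φ τ) ^ 2 :=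
      intervalIntegral.integral_mono_interval le_rfl hs hst
        (Eventually.of_forall fun τ => sq_nonneg (φ τ)) ((hφ.pow 2).intervalIntegrable 0 t)
    rw [hsol t (hs.trans hst) μ, hsol s hs μ, abs_mul, abs_mul, Real.abs_exp, Real.abs_exp]
    exact mul_le_mul_of_nonneg_left (Real.exp_le_exp.mpr
      (mul_le_mul_of_nonpos_left hmono (neg_nonpos.mpr (hγ μ).le))) (abs_nonneg _)
end

section
/- Let Γ be a symmetric positive definite real n×n matrix, let Ĉ : ℝ → ℝ^{n×n} be entrywise continuous, symmetric-valued, with ‖Ĉ(t)‖ ≤ B for all t ≥ 0 (operator norm), and assume Ĉ satisfies PE(α,T) for some α, T > 0. Let w : ℝ → ℝⁿ be continuous with ‖w(t)‖ ≤ d for all t ≥ 0. Then there exist constants κ, λ, c > 0, depending only on n, α, T, B, and Γ (not on d or on the solution), such that every differentiable θ̃ : [0,∞) → ℝⁿ satisfying the disturbed gradient-estimator error dynamics θ̃'(t) = −Γ Ĉ(t)ᵀ Ĉ(t) θ̃(t) + Γ w(t) for all t ≥ 0 obeys ‖θ̃(t)‖ ≤ κ e^{−λ t} ‖θ̃(0)‖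 + c·d for all t ≥ 0. In particular the estimation error is ultimately bounded by a bound that is a continuous, strictly increasing function of d vanishing at d = 0. -/
open Matrix MeasureTheory

open scoped InnerProductSpace

/-- A scalar function with `W' ≤ -μ W + b` on `[0, ∞)` decays exponentially up to the level
`b / μ`. -/
theorem le_exp_mul_add_div_of_deriv_le {W W' : ℝ → ℝ} {μ b : ℝ} (hμ : 0 < μ) (hb : 0 ≤ b)
    (hW : ∀ t ≥ (0 : ℝ), HasDerivWithinAt W (W' t) (Set.Ici 0) t)
    (hW' : ∀ t ≥ (0 : ℝ), W' t ≤ -μ * W t + b) {t : ℝ} (ht : 0 ≤ t) :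
    W t ≤ Real.exp (-μ * t) * W 0 + b / μ := by
  have hd : ∀ s ≥ (0 : ℝ), HasDerivWithinAt (fun s => Real.exp (μ * s) * (W s - b / μ))
      (Real.exp (μ * s) * μ * (W s - b / μ) + Real.exp (μ * s) * W' s) (Set.Ici 0) s := by
    intro s hs
    have h1 : HasDerivAt (fun s : ℝ => Real.exp (μ * s)) (Real.exp (μ * s) * μ) s := by
      simpa using ((hasDerivAt_id s).const_mul μ).exp
    exact h1.hasDerivWithinAt.mul ((hW s hs).sub_const _)
  have hanti : AntitoneOn (fun s => Real.exp (μ * s) * (W s - b / μ)) (Set.Ici 0) := by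
    refine antitoneOn_of_hasDerivWithinAt_nonpos (convex_Ici 0)
      (fun s hs => (hd s hs).continuousWithinAt)
      (fun s hs => (hd s (interior_subset hs)).mono interior_subset) ?_
    intro s hs
    have h := hW' s (interior_subset hs)
    have he := Real.exp_pos (μ * s)
    have : Real.exp (μ * s) * μ * (W s - b / μ) + Real.exp (μ * s) * W' s
        = Real.exp (μ * s) * (μ * W s - b + W' s) := by field_simp
    rw [this]
    exact mul_nonpos_of_nonneg_of_nonpos he.le (by linarith)
  have h0 := hanti (Set.mem_Ici.2 le_rfl) (Set.mem_Ici.2 ht) ht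
  simp only [mul_zero, Real.exp_zero, one_mul] at h0
  have he := Real.exp_pos (-μ * t)
  have hmul : Real.exp (-μ * t) * Real.exp (μ * t) = 1 := by
    rw [← Real.exp_add]; simp
  have h1 := mul_le_mul_of_nonneg_left h0 he.le
  rw [← mul_assoc, hmul, one_mul] at h1
  have h2 : 0 ≤ Real.exp (-μ * t) * (b / μ) := by positivity
  linarith

section Weight

variable {F : Type*} [NormedAddCommGroup F] [NormedSpace ℝ F]

/-- The weighted window average `∫ s in t..t+T, (t + T - s) • G s`, written through the iterated
primitive of `G`. -/
noncomputable def windowWeight (G : ℝ → F) (T t : ℝ) : F :=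
  (∫ s in t..(t + T), ∫ r in (0 : ℝ)..s, G r) - T • ∫ r in (0 : ℝ)..t, G r

variable [CompleteSpace F] {G : ℝ → F}

theorem hasDerivAt_windowWeight (hG : Continuous G) (T t : ℝ) :
    HasDerivAt (windowWeight G T) ((∫ s in t..(t + T), G s) - T • G t) t := by
  have hH : ∀ u, HasDerivAt (fun u => ∫ r in (0 : ℝ)..u, G r) (G u) u :=
    fun u => (hG.integral_hasStrictDerivAt 0 u).hasDerivAt
  have hHc : Continuous fun u => ∫ r in (0 : ℝ)..u, G r :=
    continuous_iff_continuousAt.2 fun u => (hH u).continuousAt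
  have hK : ∀ u, HasDerivAt (fun u => ∫ s in (0 : ℝ)..u, ∫ r in (0 : ℝ)..s, G r)
      (∫ r in (0 : ℝ)..u, G r) u :=
    fun u => (hHc.integral_hasStrictDerivAt 0 u).hasDerivAt
  have h1 := (((hK (t + T)).comp_add_const t T).sub (hK t)).sub ((hH t).const_smul T)
  rw [intervalIntegral.integral_interval_sub_left (hG.intervalIntegrable _ _)
    (hG.intervalIntegrable _ _)] at h1
  convert h1 using 1
  funext u
  simp only [windowWeight, Pi.sub_apply, Pi.smul_apply]
  rw [intervalIntegral.integral_interval_sub_left (hHc.intervalIntegrable _ _)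
    (hHc.intervalIntegrable _ _)]

theorem norm_windowWeight_le (hG : Continuous G) {T t b : ℝ} (hT : 0 ≤ T) (ht : 0 ≤ t)
    (hb : 0 ≤ b) (hGb : ∀ s ≥ (0 : ℝ), ‖G s‖ ≤ b) :
    ‖windowWeight G T t‖ ≤ b * T * T := by
  have hHc : Continuous fun u => ∫ r in (0 : ℝ)..u, G r :=
    continuous_iff_continuousAt.2 fun u =>
      (hG.integral_hasStrictDerivAt 0 u).hasDerivAt.continuousAt
  have heq : windowWeight G T t = ∫ s in t..(t + T), ∫ r in t..s, G r := by
    have : ∀ s, ∫ r in t..s, G r = (∫ r in (0 : ℝ)..s, G r) - ∫ r in (0 : ℝ)..t, G r :=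
      fun s => (intervalIntegral.integral_interval_sub_left (hG.intervalIntegrable _ _)
        (hG.intervalIntegrable _ _)).symm
    simp only [this]
    rw [intervalIntegral.integral_sub (hHc.intervalIntegrable _ _) (by simp)]
    simp [windowWeight]
  rw [heq]
  have h := intervalIntegral.norm_integral_le_of_norm_le_const (a := t) (b := t + T)
    (f := fun s => ∫ r in t..s, G r) (C := b * T) ?_
  · simpa [abs_of_nonneg hT] using h
  · intro s hs
    rw [Set.uIoc_of_le (by linarith)] at hs
    have h2 := intervalIntegral.norm_integral_le_of_norm_le_const (a := t) (b := s)
      (f := G) (C := b) ?_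
    · rw [abs_of_nonneg (by linarith [hs.1])] at h2
      exact h2.trans (mul_le_mul_of_nonneg_left (by linarith [hs.2]) hb)
    · intro r hr
      rw [Set.uIoc_of_le hs.1.le] at hr
      exact hGb r (by linarith [hr.1])

end Weight

/-- The scalar dissipation estimate behind the strict Lyapunov function: completing squares in
the regressor output `y` and in the disturbance level `d`. -/
theorem dissipation_estimate {α T k q d x y : ℝ} (hα : 0 < α) (r : ℝ)
    (hT : 0 ≤ T) (hk : T + 4 * r ^ 2 / α ≤ k) :
    -2 * k * y ^ 2 + 2 * k * x * d - α * x ^ 2 + T * y ^ 2 + 2 * r * x * y + 2 * q * x * d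
      ≤ -(α / 2) * x ^ 2 + 4 * (k + q) ^ 2 / α * d ^ 2 := by
  have h1 : 2 * r * x * y ≤ α / 4 * x ^ 2 + 4 * r ^ 2 / α * y ^ 2 := by
    have : α / 4 * x ^ 2 + 4 * r ^ 2 / α * y ^ 2 - 2 * r * x * y
        = (α * x - 4 * r * y) ^ 2 / (4 * α) := by field_simp; ring
    have h : 0 ≤ (α * x - 4 * r * y) ^ 2 / (4 * α) := by positivity
    linarith
  have h2 : 2 * (k + q) * x * d ≤ α / 4 * x ^ 2 + 4 * (k + q) ^ 2 / α * d ^ 2 := by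
    have : α / 4 * x ^ 2 + 4 * (k + q) ^ 2 / α * d ^ 2 - 2 * (k + q) * x * d
        = (α * x - 4 * (k + q) * d) ^ 2 / (4 * α) := by field_simp; ring
    have h : 0 ≤ (α * x - 4 * (k + q) * d) ^ 2 / (4 * α) := by positivity
    linarith
  have h3 := mul_le_mul_of_nonneg_right hk (sq_nonneg y)
  have h4 : 0 ≤ (T + 4 * r ^ 2 / α) * y ^ 2 := by positivity
  linarith

section Hilbert

variable {E : Type*} [NormedAddCommGroup E] [InnerProductSpace ℝ E] [CompleteSpace E]

open ContinuousLinearMap in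
/-- Input-to-state stability of the disturbed, persistently excited gradient flow in a Hilbert
space. The operator `P` plays the role of the inverse of the gain `Γ`. -/
theorem exists_iss_gradient_flow {α T B p : ℝ} (hα : 0 < α) (hT : 0 < T) (hB : 0 < B)
    (hp : 0 < p) (Γ P : E →L[ℝ] E) (hPΓ : ∀ x, P (Γ x) = x)
    (hPsymm : ∀ x y, ⟪P x, y⟫_ℝ = ⟪x, P y⟫_ℝ) (hPpos : ∀ x, p * ‖x‖ ^ 2 ≤ ⟪x, P x⟫_ℝ) :
    ∃ κ > (0 : ℝ), ∃ lam > (0 : ℝ), ∃ c > (0 : ℝ),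
      ∀ C : ℝ → E →L[ℝ] E, Continuous C → (∀ t ≥ (0 : ℝ), ‖C t‖ ≤ B) →
        (∀ t ≥ (0 : ℝ), ∀ x,
          α * ‖x‖ ^ 2 ≤ ⟪x, (∫ s in t..(t + T), adjoint (C s) ∘L C s) x⟫_ℝ) →
        ∀ d : ℝ, ∀ w : ℝ → E, (∀ t ≥ (0 : ℝ), ‖w t‖ ≤ d) →
          ∀ θ : ℝ → E,
            (∀ t ≥ (0 : ℝ), HasDerivWithinAt θ
              (-(Γ ((adjoint (C t) ∘L C t) (θ t))) + Γ (w t)) (Set.Ici 0) t) →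
            ∀ t ≥ (0 : ℝ), ‖θ t‖ ≤ κ * Real.exp (-lam * t) * ‖θ 0‖ + c * d := by
  set m : ℝ := B * B * T * T with hm
  have hm0 : 0 < m := by positivity
  set g : ℝ := ‖Γ‖ with hg
  have hg0 : 0 ≤ g := norm_nonneg _
  set k : ℝ := T + 4 * (m * g * B) ^ 2 / α + (m + 1) / p with hk
  have hk0 : 0 < k := by positivity
  have hkp : m + 1 ≤ k * p := by
    have h : (m + 1) / p ≤ k := by
      have : 0 ≤ T + 4 * (m * g * B) ^ 2 / α := by positivity
      linarith
    rwa [div_le_iff₀ hp] at h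
  set L : ℝ := k * ‖P‖ + m with hL
  have hL0 : 0 < L := by positivity
  set K : ℝ := 4 * (k + m * g) ^ 2 / α with hK
  have hK0 : 0 < K := by positivity
  set μ : ℝ := α / (2 * L) with hμ
  have hμ0 : 0 < μ := by positivity
  refine ⟨√L, by positivity, μ / 2, by positivity, √(K / μ), by positivity, ?_⟩
  intro C hC hCB hPE d w hw θ hθ
  have hd : 0 ≤ d := (norm_nonneg _).trans (hw 0 le_rfl)
  set G : ℝ → E →L[ℝ] E := fun t => adjoint (C t) ∘L C t with hG
  have hGc : Continuous G := ((adjoint (𝕜 := ℝ) (E := E) (F := E)).continuous.comp hC).clm_comp hC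
  have hGb : ∀ t ≥ (0 : ℝ), ‖G t‖ ≤ B * B := fun t ht => by
    refine (opNorm_comp_le _ _).trans ?_
    rw [LinearIsometryEquiv.norm_map]
    exact mul_le_mul (hCB t ht) (hCB t ht) (norm_nonneg _) hB.le
  have hGin : ∀ t x, ⟪x, G t x⟫_ℝ = ‖C t x‖ ^ 2 := fun t x => by
    simp only [hG, coe_comp, Function.comp_apply]
    rw [adjoint_inner_right, real_inner_self_eq_norm_sq]
  have hGn : ∀ t ≥ (0 : ℝ), ∀ x, ‖G t x‖ ≤ B * ‖C t x‖ := fun t ht x => by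
    refine (le_opNorm (adjoint (C t)) (C t x)).trans ?_
    rw [LinearIsometryEquiv.norm_map]
    exact mul_le_mul_of_nonneg_right (hCB t ht) (norm_nonneg _)
  set N : ℝ → E →L[ℝ] E := windowWeight G T with hN
  have hNb : ∀ t ≥ (0 : ℝ), ‖N t‖ ≤ m := fun t ht =>
    norm_windowWeight_le hGc hT.le ht (by positivity) hGb
  have hNbil : ∀ t ≥ (0 : ℝ), ∀ x y, |⟪x, N t y⟫_ℝ| ≤ m * ‖x‖ * ‖y‖ := fun t ht x y => by
    have h1 := abs_real_inner_le_norm x (N t y)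
    have h2 : ‖N t y‖ ≤ m * ‖y‖ := (N t).le_of_opNorm_le (hNb t ht) y
    have h3 := mul_le_mul_of_nonneg_left h2 (norm_nonneg x)
    linarith
  set θ' : ℝ → E := fun t => -(Γ (G t (θ t))) + Γ (w t) with hθ'
  have hPθ' : ∀ t, P (θ' t) = -(G t (θ t)) + w t := fun t => by
    simp only [hθ', map_add, map_neg, hPΓ]
  have hW : ∀ t ≥ (0 : ℝ), HasDerivWithinAt
      (fun t => k * ⟪θ t, P (θ t)⟫_ℝ - ⟪θ t, N t (θ t)⟫_ℝ)
      (k * (⟪θ t, P (θ' t)⟫_ℝ + ⟪θ' t, P (θ t)⟫_ℝ)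
        - (⟪θ t, ((∫ s in t..(t + T), G s) - T • G t) (θ t) + N t (θ' t)⟫_ℝ
          + ⟪θ' t, N t (θ t)⟫_ℝ)) (Set.Ici 0) t := fun t ht => by
    have h1 := hθ t ht
    have h2 : HasDerivWithinAt (fun t => P (θ t)) (P (θ' t)) (Set.Ici 0) t :=
      P.hasFDerivAt.comp_hasDerivWithinAt t h1
    have h3 := (hasDerivAt_windowWeight hGc T t).hasDerivWithinAt (s := Set.Ici 0)
    exact ((h1.inner ℝ h2).const_mul k).sub (h1.inner ℝ (h3.clm_apply h1))
  have hupper : ∀ t ≥ (0 : ℝ),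
      k * ⟪θ t, P (θ t)⟫_ℝ - ⟪θ t, N t (θ t)⟫_ℝ ≤ L * ‖θ t‖ ^ 2 := fun t ht => by
    have h1 := (abs_le.1 (hNbil t ht (θ t) (θ t))).1
    have h2 : ⟪θ t, P (θ t)⟫_ℝ ≤ ‖θ t‖ * (‖P‖ * ‖θ t‖) :=
      (real_inner_le_norm _ _).trans
        (mul_le_mul_of_nonneg_left (P.le_opNorm _) (norm_nonneg _))
    have h3 := mul_le_mul_of_nonneg_left h2 hk0.le
    rw [hL]
    linarith
  have hlower : ∀ t ≥ (0 : ℝ),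
      ‖θ t‖ ^ 2 ≤ k * ⟪θ t, P (θ t)⟫_ℝ - ⟪θ t, N t (θ t)⟫_ℝ := fun t ht => by
    have h1 := (abs_le.1 (hNbil t ht (θ t) (θ t))).2
    have h2 := mul_le_mul_of_nonneg_left (hPpos (θ t)) hk0.le
    have h3 := mul_le_mul_of_nonneg_right hkp (sq_nonneg ‖θ t‖)
    linarith
  have hdiss : ∀ t ≥ (0 : ℝ),
      k * (⟪θ t, P (θ' t)⟫_ℝ + ⟪θ' t, P (θ t)⟫_ℝ)
        - (⟪θ t, ((∫ s in t..(t + T), G s) - T • G t) (θ t) + N t (θ' t)⟫_ℝ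
          + ⟪θ' t, N t (θ t)⟫_ℝ)
      ≤ -μ * (k * ⟪θ t, P (θ t)⟫_ℝ - ⟪θ t, N t (θ t)⟫_ℝ) + K * d ^ 2 := fun t ht => by
    have e1 : ⟪θ t, P (θ' t)⟫_ℝ = -‖C t (θ t)‖ ^ 2 + ⟪θ t, w t⟫_ℝ := by
      rw [hPθ', inner_add_right, inner_neg_right, hGin]
    have e2 : ⟪θ' t, P (θ t)⟫_ℝ = -‖C t (θ t)‖ ^ 2 + ⟪θ t, w t⟫_ℝ := by
      rw [← hPsymm, real_inner_comm, e1]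
    have e3 : ⟪θ t, ((∫ s in t..(t + T), G s) - T • G t) (θ t) + N t (θ' t)⟫_ℝ
        = ⟪θ t, (∫ s in t..(t + T), G s) (θ t)⟫_ℝ - T * ‖C t (θ t)‖ ^ 2
          + ⟪θ t, N t (θ' t)⟫_ℝ := by
      rw [inner_add_right, _root_.sub_apply, _root_.smul_apply, inner_sub_right, real_inner_smul_right, hGin]
    have h1 : ⟪θ t, w t⟫_ℝ ≤ ‖θ t‖ * d := (real_inner_le_norm _ _).trans
      (mul_le_mul_of_nonneg_left (hw t ht) (norm_nonneg _))
    have h2 := (abs_le.1 (hNbil t ht (θ t) (θ' t))).1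
    have h3 := (abs_le.1 (hNbil t ht (θ' t) (θ t))).1
    have h4 : ‖θ' t‖ ≤ g * (B * ‖C t (θ t)‖) + g * d := by
      refine (norm_add_le _ _).trans (add_le_add ?_ ?_)
      · rw [norm_neg]
        exact (Γ.le_opNorm _).trans (mul_le_mul_of_nonneg_left (hGn t ht _) hg0)
      · exact (Γ.le_opNorm _).trans (mul_le_mul_of_nonneg_left (hw t ht) hg0)
    have h5 := mul_le_mul_of_nonneg_left h4 (mul_nonneg hm0.le (norm_nonneg (θ t)))
    have h6 := hPE t ht (θ t)
    have h7 := dissipation_estimate (T := T) (k := k) (q := m * g) (d := d) (x := ‖θ t‖)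
      (y := ‖C t (θ t)‖) hα (m * g * B) hT.le (by
        have : 0 ≤ (m + 1) / p := by positivity
        linarith)
    have h8 := mul_le_mul_of_nonneg_left (hupper t ht) hμ0.le
    have h9 : μ * (L * ‖θ t‖ ^ 2) = α / 2 * ‖θ t‖ ^ 2 := by
      rw [hμ]; field_simp
    have h10 := mul_le_mul_of_nonneg_left h1 hk0.le
    rw [e1, e2, e3]
    rw [← hK] at h7
    linarith
  intro t ht
  have hgr := le_exp_mul_add_div_of_deriv_le hμ0 (by positivity) hW hdiss ht
  have hexp : Real.exp (-μ * t) = Real.exp (-(μ / 2) * t) ^ 2 := by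
    rw [← Real.exp_nat_mul]; congr 1; push_cast; ring
  have hsq : ‖θ t‖ ^ 2 ≤
      (√L * Real.exp (-(μ / 2) * t) * ‖θ 0‖) ^ 2 + (√(K / μ) * d) ^ 2 := by
    have h1 := mul_le_mul_of_nonneg_left (hupper 0 le_rfl) (Real.exp_pos (-μ * t)).le
    have h2 := hlower t ht
    rw [mul_pow, mul_pow, mul_pow, Real.sq_sqrt hL0.le, Real.sq_sqrt (by positivity), ← hexp]
    have h3 : K * d ^ 2 / μ = K / μ * d ^ 2 := by ring
    linarith
  have ha : 0 ≤ √L * Real.exp (-(μ / 2) * t) * ‖θ 0‖ := by positivity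
  have hb : 0 ≤ √(K / μ) * d := by positivity
  refine le_of_sq_le_sq ?_ (by positivity)
  nlinarith [mul_nonneg ha hb]

end Hilbert

section EuclideanMatrix

variable {n : ℕ}

theorem euclNorm_eq_norm_toLp (v : Fin n → ℝ) : euclNorm v = ‖WithLp.toLp 2 v‖ := by
  simp [euclNorm, EuclideanSpace.norm_eq]

theorem continuous_toEuclideanCLM_of_entries {C : ℝ → Matrix (Fin n) (Fin n) ℝ}
    (hC : ∀ i j, Continuous fun t => C t i j) :
    Continuous fun t => toEuclideanCLM (𝕜 := ℝ) (C t) := by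
  have h : Continuous C := continuous_pi fun i => continuous_pi fun j => hC i j
  exact (LinearMap.continuous_of_finiteDimensional
    ((toEuclideanCLM (n := Fin n) (𝕜 := ℝ)).toAlgEquiv.toLinearMap)).comp h

open ContinuousLinearMap in
theorem toEuclideanCLM_transpose_mul_self (A : Matrix (Fin n) (Fin n) ℝ) :
    toEuclideanCLM (𝕜 := ℝ) (Aᵀ * A) =
      adjoint (toEuclideanCLM (𝕜 := ℝ) A) ∘L toEuclideanCLM (𝕜 := ℝ) A := by
  rw [← conjTranspose_eq_transpose_of_trivial, ← star_eq_conjTranspose, map_mul, map_star]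
  rfl

theorem inner_integral_toEuclideanCLM {A : ℝ → Matrix (Fin n) (Fin n) ℝ}
    (hA : ∀ i j, Continuous fun t => A t i j) (a b : ℝ) (x : EuclideanSpace ℝ (Fin n)) :
    ⟪x, (∫ s in a..b, toEuclideanCLM (𝕜 := ℝ) (A s)) x⟫_ℝ
      = x ⬝ᵥ (Matrix.of fun i j => ∫ s in a..b, A s i j) *ᵥ x := by
  have hc := continuous_toEuclideanCLM_of_entries hA
  have hcx : Continuous fun s => toEuclideanCLM (𝕜 := ℝ) (A s) x := hc.clm_apply continuous_const
  have hi : ∀ i j, Continuous fun s => x i * (A s i j * x j) := fun i j =>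
    continuous_const.mul ((hA i j).mul continuous_const)
  have hi' : ∀ i, Continuous fun s => ∑ j, x i * (A s i j * x j) := fun i =>
    continuous_finsetSum _ fun j _ => hi i j
  rw [ContinuousLinearMap.intervalIntegral_apply (hc.intervalIntegrable _ _),
    ← innerSL_apply_apply ℝ x,
    ← (innerSL ℝ x).intervalIntegral_comp_comm (hcx.intervalIntegrable _ _)]
  simp only [innerSL_apply_apply, inner_toEuclideanCLM, dotProduct, mulVec, Finset.mul_sum,
    Matrix.of_apply]
  rw [intervalIntegral.integral_finsetSum fun i _ => (hi' i).intervalIntegrable _ _]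
  refine Finset.sum_congr rfl fun i _ => ?_
  rw [intervalIntegral.integral_finsetSum fun j _ => (hi i j).intervalIntegrable _ _]
  refine Finset.sum_congr rfl fun j _ => ?_
  rw [intervalIntegral.integral_const_mul, intervalIntegral.integral_mul_const]

open scoped MatrixOrder in
/-- The inverse of a positive definite matrix is coercive. -/
theorem Matrix.PosDef.exists_inv_coercive {Γ : Matrix (Fin n) (Fin n) ℝ} (hΓ : Γ.PosDef) :
    ∃ p > (0 : ℝ), ∀ x : EuclideanSpace ℝ (Fin n),
      p * ‖x‖ ^ 2 ≤ ⟪x, toEuclideanCLM (𝕜 := ℝ) Γ⁻¹ x⟫_ℝ := by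
  classical
  have hdet : IsUnit Γ.det := (Matrix.isUnit_iff_isUnit_det _).1 hΓ.isUnit
  set R : EuclideanSpace ℝ (Fin n) →L[ℝ] EuclideanSpace ℝ (Fin n) :=
    toEuclideanCLM (𝕜 := ℝ) (CFC.sqrt Γ) with hR
  have hRadj : ContinuousLinearMap.adjoint R = R := by
    have h : star (CFC.sqrt Γ) = CFC.sqrt Γ := (CFC.sqrt_nonneg Γ).isSelfAdjoint
    rw [← ContinuousLinearMap.star_eq_adjoint, hR, ← map_star, h]
  have hRR : R * R = toEuclideanCLM (𝕜 := ℝ) Γ := by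
    rw [hR, ← map_mul, CFC.sqrt_mul_sqrt_self Γ hΓ.posSemidef.nonneg]
  have hRRinv : ∀ x, R (R (toEuclideanCLM (𝕜 := ℝ) Γ⁻¹ x)) = x := fun x => by
    have h : R * R * toEuclideanCLM (𝕜 := ℝ) Γ⁻¹ = 1 := by
      rw [hRR, ← map_mul, Matrix.mul_nonsing_inv _ hdet, map_one]
    exact congrArg (fun f => f x) h
  refine ⟨1 / (‖R‖ ^ 2 + 1), by positivity, fun x => ?_⟩
  set y := toEuclideanCLM (𝕜 := ℝ) Γ⁻¹ x with hy
  have hxy : ⟪x, y⟫_ℝ = ‖R y‖ ^ 2 := by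
    conv_lhs => rw [← hRRinv x, ← hy]
    nth_rewrite 1 [← hRadj]
    rw [ContinuousLinearMap.adjoint_inner_left, real_inner_self_eq_norm_sq]
  have hx : ‖x‖ ≤ ‖R‖ * ‖R y‖ := by
    conv_lhs => rw [← hRRinv x, ← hy]
    exact R.le_opNorm _
  have hx2 : ‖x‖ ^ 2 ≤ ‖R‖ ^ 2 * ‖R y‖ ^ 2 := by
    rw [← mul_pow]
    exact pow_le_pow_left₀ (norm_nonneg _) hx 2
  rw [hxy, div_mul_eq_mul_div, one_mul, div_le_iff₀ (by positivity)]
  linarith [sq_nonneg ‖R y‖]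

end EuclideanMatrix

/-- (Input-to-state stability of the disturbed gradient flow.)
There exist `κ, λ, c > 0` depending only on `n, α, T, B, Γ` — not on the
disturbance level `d`, the disturbance `w`, the regressor `Ĉ`, or the solution —
such that every solution of `θ̃' = −Γ ĈᵀĈ θ̃ + Γ w` with `Ĉ` symmetric-valued,
bounded by `B` and `PE(α,T)`, and `‖w(t)‖ ≤ d`, satisfies
`‖θ̃(t)‖ ≤ κ e^{−λ t} ‖θ̃(0)‖ + c d` for all `t ≥ 0`. -/
theorem disturbed_gradient_estimator_ISS (n : ℕ) (α T B : ℝ)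
    (hα : 0 < α) (hT : 0 < T) (hB : 0 < B)
    (Γ : Matrix (Fin n) (Fin n) ℝ) (hΓ : Γ.PosDef) :
    ∃ κ > (0 : ℝ), ∃ lam > (0 : ℝ), ∃ c > (0 : ℝ),
      ∀ Chat : ℝ → Matrix (Fin n) (Fin n) ℝ,
        (∀ i j, Continuous fun t => Chat t i j) →
        (∀ t, (Chat t).IsSymm) →
        (∀ t ≥ (0 : ℝ), ∀ v : Fin n → ℝ,
          euclNorm ((Chat t).mulVec v) ≤ B * euclNorm v) →
        IsPE Chat α T →
        ∀ d : ℝ, ∀ w : ℝ → (Fin n → ℝ),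
          (∀ i, Continuous fun t => w t i) →
          (∀ t ≥ (0 : ℝ), euclNorm (w t) ≤ d) →
          ∀ θtil : ℝ → (Fin n → ℝ),
            (∀ t ≥ (0 : ℝ), HasDerivWithinAt θtil
              (-(Γ.mulVec (((Chat t)ᵀ * Chat t).mulVec (θtil t))) +
                Γ.mulVec (w t)) (Set.Ici 0) t) →
            ∀ t ≥ (0 : ℝ),
              euclNorm (θtil t) ≤
                κ * Real.exp (-lam * t) * euclNorm (θtil 0) + c * d := by
  obtain ⟨p, hp, hpΓ⟩ := hΓ.exists_inv_coercive
  have hdet : IsUnit Γ.det := (Matrix.isUnit_iff_isUnit_det _).1 hΓ.isUnit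
  have hinv : ∀ x, toEuclideanCLM (𝕜 := ℝ) Γ⁻¹ (toEuclideanCLM (𝕜 := ℝ) Γ x) = x := fun x => by
    have h : toEuclideanCLM (𝕜 := ℝ) Γ⁻¹ * toEuclideanCLM (𝕜 := ℝ) Γ = 1 := by
      rw [← map_mul, Matrix.nonsing_inv_mul _ hdet, map_one]
    exact congrArg (fun f => f x) h
  have hsymm : ∀ x y, ⟪toEuclideanCLM (𝕜 := ℝ) Γ⁻¹ x, y⟫_ℝ
      = ⟪x, toEuclideanCLM (𝕜 := ℝ) Γ⁻¹ y⟫_ℝ := fun x y => by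
    have h : star Γ⁻¹ = Γ⁻¹ := hΓ.isHermitian.inv
    rw [← ContinuousLinearMap.adjoint_inner_right, ← ContinuousLinearMap.star_eq_adjoint,
      ← map_star, h]
  obtain ⟨κ, hκ, lam, hlam, c, hc, hmain⟩ :=
    exists_iss_gradient_flow hα hT hB hp _ _ hinv hsymm hpΓ
  refine ⟨κ, hκ, lam, hlam, c, hc, fun Chat hcont _ hbound hPE d w _ hw θtil hθ t ht => ?_⟩
  simp only [euclNorm_eq_norm_toLp] at hbound hw ⊢
  refine hmain (fun t => toEuclideanCLM (𝕜 := ℝ) (Chat t))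
    (continuous_toEuclideanCLM_of_entries hcont) (fun s hs => ?_) (fun s hs x => ?_) d
    (fun s => WithLp.toLp 2 (w s)) hw (fun s => WithLp.toLp 2 (θtil s)) (fun s hs => ?_) t ht
  · exact ContinuousLinearMap.opNorm_le_bound _ hB.le fun x => hbound s hs (WithLp.ofLp x)
  · have hCC : ∀ i j, Continuous fun s => ((Chat s)ᵀ * Chat s) i j := fun i j => by
      simp only [Matrix.mul_apply, Matrix.transpose_apply]
      exact continuous_finsetSum _ fun l _ => (hcont l i).mul (hcont l j)
    have h := (hPE s hs).dotProduct_mulVec_nonneg (WithLp.ofLp x)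
    simp only [← toEuclideanCLM_transpose_mul_self]
    rw [inner_integral_toEuclideanCLM hCC, EuclideanSpace.real_norm_sq_eq]
    rw [Matrix.sub_mulVec, Matrix.smul_mulVec, Matrix.one_mulVec, dotProduct_sub,
      dotProduct_smul, star_trivial, smul_eq_mul] at h
    have hxx : WithLp.ofLp x ⬝ᵥ WithLp.ofLp x = ∑ i, x i ^ 2 := by
      simp [dotProduct, sq]
    rw [hxx] at h
    linarith
  · rw [← toEuclideanCLM_transpose_mul_self]
    exact (PiLp.continuousLinearEquiv 2 ℝ fun _ : Fin n => ℝ).symm.hasFDerivAt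
      |>.comp_hasDerivWithinAt s (hθ s hs)
end
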